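/- The Bellman operator is a γ-contraction with respect to the sup norm: for all bounded functions U, V : S → ℝ such that w ↦ U(T(s,a,w)) and w ↦ V(T(s,a,w)) are Lebesgue-measurable for every s ∈ S and a ∈ A(s), one has sup_{s∈S} |(BU)(s) − (BV)(s)| ≤ γ · sup_{s∈S} |U(s) − V(s)|. -/

import Mathlib

open MeasureTheory Set Filter

/-- Lebesgue measure on the unit interval `[0,1]`. -/
noncomputable def leb01 : Measure ℝ := volume.restrict (Icc (0 : ℝ) 1)

/-- A bounded real-valued function. -/
def Bdd {α : Type*} (f : α → ℝ) : Prop := ∃ C : ℝ, ∀ x, |f x| ≤ C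

/-- `M` is a risk envelope: a nonempty set of (Lebesgue-)measurable probability densities on
`[0,1]`, i.e. `Q ≥ 0` a.e. and `∫₀¹ Q(w) dw = 1`. -/
def IsRiskEnvelope (M : Set (ℝ → ℝ)) : Prop :=
  M.Nonempty ∧ ∀ Q ∈ M, AEMeasurable Q leb01 ∧ (0 ≤ᵐ[leb01] Q) ∧ ∫ w, Q w ∂leb01 = 1

/-- The dual-form risk mapping `ς(f) = inf_{Q ∈ M} ∫₀¹ f(w) Q(w) dw`. -/
noncomputable def dualRisk (M : Set (ℝ → ℝ)) (f : ℝ → ℝ) : ℝ :=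
  ⨅ Q : M, ∫ w, f w * (Q : ℝ → ℝ) w ∂leb01

/-- The Bellman operator `(BV)(s) = sup_{a ∈ A(s)} [ r(s,a) + γ · ς(V(T(s,a,·))) ]`, built from
a risk mapping `ς`. -/
noncomputable def bellman {S A : Type*} (ς : (ℝ → ℝ) → ℝ) (Aset : S → Set A)
    (T : S → A → ℝ → S) (r : S → A → ℝ) (γ : ℝ) (V : S → ℝ) : S → ℝ :=
  fun s => ⨆ a : Aset s, (r s a + γ * ς fun w => V (T s a w))

lemma env_integrable {Q : ℝ → ℝ} (h1 : ∫ w, Q w ∂leb01 = 1) : Integrable Q leb01 := by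
  by_contra h
  rw [integral_undef h] at h1
  exact zero_ne_one h1

lemma env_integrable_mul {Q f : ℝ → ℝ} (h1 : ∫ w, Q w ∂leb01 = 1)
    (hf : AEMeasurable f leb01) {C : ℝ} (hC : ∀ w, |f w| ≤ C) :
    Integrable (fun w => f w * Q w) leb01 :=
  (env_integrable h1).bdd_mul hf.aestronglyMeasurable
    (Eventually.of_forall (fun w => by simpa using hC w))

lemma env_le {Q f g : ℝ → ℝ} (h0 : 0 ≤ᵐ[leb01] Q) (h1 : ∫ w, Q w ∂leb01 = 1)
    (hf : AEMeasurable f leb01) {C : ℝ} (hC : ∀ w, |f w| ≤ C)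
    (hg : AEMeasurable g leb01) {C' : ℝ} (hC' : ∀ w, |g w| ≤ C') {D : ℝ}
    (h : ∀ w, f w ≤ g w + D) :
    ∫ w, f w * Q w ∂leb01 ≤ (∫ w, g w * Q w ∂leb01) + D := by
  have e : (∫ w, g w * Q w ∂leb01) + D = ∫ w, (g w * Q w + D * Q w) ∂leb01 := by
    rw [integral_add (env_integrable_mul h1 hg hC') ((env_integrable h1).const_mul D),
      integral_const_mul, h1, mul_one]
  rw [e]
  refine integral_mono_ae (env_integrable_mul h1 hf hC)
    ((env_integrable_mul h1 hg hC').add ((env_integrable h1).const_mul D)) ?_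
  filter_upwards [h0] with w hw
  have := mul_le_mul_of_nonneg_right (h w) hw
  linarith

lemma env_ge {Q f : ℝ → ℝ} (h0 : 0 ≤ᵐ[leb01] Q) (h1 : ∫ w, Q w ∂leb01 = 1)
    (hf : AEMeasurable f leb01) {C : ℝ} (hC : ∀ w, |f w| ≤ C) :
    -C ≤ ∫ w, f w * Q w ∂leb01 := by
  have := env_le (f := fun _ => 0) (g := f) (C := 0) (D := C) h0 h1 aemeasurable_const
    (by simp) hf hC (fun w => by linarith [neg_le_of_abs_le (hC w)])
  simp only [zero_mul, integral_zero] at this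
  linarith

lemma dualRisk_bddBelow {M : Set (ℝ → ℝ)} (hM : IsRiskEnvelope M) {f : ℝ → ℝ}
    (hf : AEMeasurable f leb01) {C : ℝ} (hC : ∀ w, |f w| ≤ C) :
    BddBelow (range fun Q : M => ∫ w, f w * (Q : ℝ → ℝ) w ∂leb01) := by
  refine ⟨-C, ?_⟩
  rintro _ ⟨Q, rfl⟩
  exact env_ge (hM.2 Q Q.2).2.1 (hM.2 Q Q.2).2.2 hf hC

lemma dualRisk_le {M : Set (ℝ → ℝ)} (hM : IsRiskEnvelope M) {f g : ℝ → ℝ}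
    (hf : AEMeasurable f leb01) {C : ℝ} (hC : ∀ w, |f w| ≤ C)
    (hg : AEMeasurable g leb01) {C' : ℝ} (hC' : ∀ w, |g w| ≤ C') {D : ℝ}
    (h : ∀ w, f w ≤ g w + D) : dualRisk M f ≤ dualRisk M g + D := by
  have : Nonempty M := hM.1.to_subtype
  rw [← sub_le_iff_le_add]
  refine le_ciInf fun Q => ?_
  rw [sub_le_iff_le_add]
  exact (ciInf_le (dualRisk_bddBelow hM hf hC) Q).trans
    (env_le (hM.2 Q Q.2).2.1 (hM.2 Q Q.2).2.2 hf hC hg hC' h)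

lemma dualRisk_upper {M : Set (ℝ → ℝ)} (hM : IsRiskEnvelope M) {f : ℝ → ℝ}
    (hf : AEMeasurable f leb01) {C : ℝ} (hC : ∀ w, |f w| ≤ C) : dualRisk M f ≤ C := by
  have : Nonempty M := hM.1.to_subtype
  have := dualRisk_le (g := fun _ => 0) (C' := 0) (D := C) hM hf hC aemeasurable_const
    (by simp) (fun w => by linarith [le_of_abs_le (hC w)])
  simpa [dualRisk] using this

lemma bellman_le {S A : Type*}
    (M : Set (ℝ → ℝ)) (hM : IsRiskEnvelope M)
    (Aset : S → Set A) (hA : ∀ s, (Aset s).Nonempty)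
    (T : S → A → ℝ → S)
    (r : S → A → ℝ) (hr : Bdd fun p : S × A => r p.1 p.2)
    (γ : ℝ) (hγ0 : 0 ≤ γ)
    (U V : S → ℝ) (hU : Bdd U) (hV : Bdd V)
    (hU_meas : ∀ s : S, ∀ a ∈ Aset s, AEMeasurable (fun w => U (T s a w)) leb01)
    (hV_meas : ∀ s : S, ∀ a ∈ Aset s, AEMeasurable (fun w => V (T s a w)) leb01)
    (D : ℝ) (hD : ∀ s, |U s - V s| ≤ D) (s : S) :
    bellman (dualRisk M) Aset T r γ U s ≤ bellman (dualRisk M) Aset T r γ V s + γ * D := by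
  obtain ⟨R, hR⟩ := hr
  obtain ⟨CU, hCU⟩ := hU
  obtain ⟨CV, hCV⟩ := hV
  have : Nonempty (Aset s) := (hA s).to_subtype
  refine ciSup_le fun a => ?_
  have hb : BddAbove (range fun a : Aset s =>
      r s a + γ * dualRisk M fun w => V (T s a w)) := by
    refine ⟨R + γ * CV, ?_⟩
    rintro _ ⟨a, rfl⟩
    exact add_le_add (le_of_abs_le (hR (s, a.1)))
      (mul_le_mul_of_nonneg_left
        (dualRisk_upper hM (hV_meas s a a.2) (fun w => hCV _)) hγ0)
  have h1 := le_ciSup hb a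
  have h2 := mul_le_mul_of_nonneg_left (dualRisk_le (D := D) hM (hU_meas s a a.2)
    (fun w => hCU _) (hV_meas s a a.2) (fun w => hCV _)
    (fun w => by linarith [le_of_abs_le (hD (T s a w))])) hγ0
  unfold bellman
  linarith

/-- The Bellman operator built from the dual-form risk mapping `ς = dualRisk M`
is a `γ`-contraction with respect to the sup norm. -/
theorem bellman_contraction
    {S A : Type*} [Nonempty S] [Nonempty A]
    (M : Set (ℝ → ℝ)) (hM : IsRiskEnvelope M)
    (Aset : S → Set A) (hA : ∀ s, (Aset s).Nonempty)
    (T : S → A → ℝ → S)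
    (r : S → A → ℝ) (hr : Bdd fun p : S × A => r p.1 p.2)
    (γ : ℝ) (hγ0 : 0 ≤ γ) (hγ1 : γ < 1)
    (U V : S → ℝ) (hU : Bdd U) (hV : Bdd V)
    (hU_meas : ∀ s : S, ∀ a ∈ Aset s, AEMeasurable (fun w => U (T s a w)) leb01)
    (hV_meas : ∀ s : S, ∀ a ∈ Aset s, AEMeasurable (fun w => V (T s a w)) leb01) :
    (⨆ s : S, |bellman (dualRisk M) Aset T r γ U s - bellman (dualRisk M) Aset T r γ V s|)
      ≤ γ * ⨆ s : S, |U s - V s| := by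
  have hb : BddAbove (range fun s => |U s - V s|) := by
    obtain ⟨CU, hCU⟩ := hU
    obtain ⟨CV, hCV⟩ := hV
    refine ⟨CU + CV, ?_⟩
    rintro _ ⟨s, rfl⟩
    exact (abs_sub _ _).trans (add_le_add (hCU s) (hCV s))
  have hD : ∀ s, |U s - V s| ≤ ⨆ s : S, |U s - V s| := fun s => le_ciSup hb s
  refine ciSup_le fun s => ?_
  have h1 := bellman_le M hM Aset hA T r hr γ hγ0 U V hU hV hU_meas hV_meas _ hD s
  have h2 := bellman_le M hM Aset hA T r hr γ hγ0 V U hV hU hV_meas hU_meas _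
    (fun s => by rw [abs_sub_comm]; exact hD s) s
  rw [abs_le]
  constructor <;> linarith
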